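/- There exists a compact metric space (X,d), a continuous map F: X → X, and an uncountable set T ⊆ X such that every pair of distinct points of T is distributionally scrambled of type 3, yet no pair of distinct points of X is distributionally scrambled of type 2 (and hence none is of type 1); moreover (X,F) admits a factor (Y,f) (a compact system with a continuous surjection π: X → Y, π ∘ F = f ∘ π) that is distributionally chaotic of type 1. -/

import Mathlib

open Filter Metric
open scoped Classical

/-- The lower distribution function of a pair `(x, y)` under the map `f`:
`Φ_{(x,y)}(δ) = liminf_{m→∞} (1/m)·#{k : 0 < k < m, d(f^k x, f^k y) < δ}`. -/
noncomputable def lowerDF {X : Type*} [MetricSpace X] (f : X → X) (x y : X) (δ : ℝ) : ℝ :=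
  liminf (fun m : ℕ =>
    (((Finset.Ioo 0 m).filter fun k => dist (f^[k] x) (f^[k] y) < δ).card : ℝ) / m) atTop

/-- The upper distribution function of a pair `(x, y)` under the map `f`:
`Φ*_{(x,y)}(δ) = limsup_{m→∞} (1/m)·#{k : 0 < k < m, d(f^k x, f^k y) < δ}`. -/
noncomputable def upperDF {X : Type*} [MetricSpace X] (f : X → X) (x y : X) (δ : ℝ) : ℝ :=
  limsup (fun m : ℕ =>
    (((Finset.Ioo 0 m).filter fun k => dist (f^[k] x) (f^[k] y) < δ).card : ℝ) / m) atTop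

/-- A pair of distinct points is distributionally scrambled of type 1 if `Φ* ≡ 1`
and `Φ(δ) = 0` for some `0 < δ ≤ diam X`. -/
def DistScrambled1 {X : Type*} [MetricSpace X] (f : X → X) (x y : X) : Prop :=
  x ≠ y ∧ (∀ δ > 0, upperDF f x y δ = 1) ∧
    ∃ δ, 0 < δ ∧ δ ≤ diam (Set.univ : Set X) ∧ lowerDF f x y δ = 0

/-- A pair of distinct points is distributionally scrambled of type 2 if `Φ* ≡ 1`
and `Φ(δ) < Φ*(δ)` for some `δ > 0`. -/
def DistScrambled2 {X : Type*} [MetricSpace X] (f : X → X) (x y : X) : Prop :=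
  x ≠ y ∧ (∀ δ > 0, upperDF f x y δ = 1) ∧
    ∃ δ > 0, lowerDF f x y δ < upperDF f x y δ

/-- A pair of distinct points is distributionally scrambled of type 3 if
`Φ(δ) < Φ*(δ)` for some `δ > 0`. -/
def DistScrambled3 {X : Type*} [MetricSpace X] (f : X → X) (x y : X) : Prop :=
  x ≠ y ∧ ∃ δ > 0, lowerDF f x y δ < upperDF f x y δ

open Topology

/-- The proportion of times `0 < k < m` at which `P` holds. -/
noncomputable def freq (P : ℕ → Prop) (m : ℕ) : ℝ :=
  (((Finset.Ioo 0 m).filter P).card : ℝ) / m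

lemma lowerDF_eq_liminf_freq {X : Type*} [MetricSpace X] (f : X → X) (x y : X) (δ : ℝ) :
    lowerDF f x y δ = liminf (freq fun k => dist (f^[k] x) (f^[k] y) < δ) atTop := by
  unfold lowerDF freq
  congr!

lemma upperDF_eq_limsup_freq {X : Type*} [MetricSpace X] (f : X → X) (x y : X) (δ : ℝ) :
    upperDF f x y δ = limsup (freq fun k => dist (f^[k] x) (f^[k] y) < δ) atTop := by
  unfold upperDF freq
  congr!

lemma freq_nonneg (P : ℕ → Prop) (m : ℕ) : 0 ≤ freq P m := by
  unfold freq; positivity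

lemma freq_le_one (P : ℕ → Prop) (m : ℕ) : freq P m ≤ 1 := by
  unfold freq
  refine div_le_one_of_le₀ ?_ (by positivity)
  have : ((Finset.Ioo 0 m).filter P).card ≤ m :=
    (Finset.card_filter_le _ _).trans (by simp)
  exact_mod_cast this

lemma isBoundedUnder_le_freq (P : ℕ → Prop) : IsBoundedUnder (· ≤ ·) atTop (freq P) :=
  isBoundedUnder_of ⟨1, freq_le_one P⟩

lemma isBoundedUnder_ge_freq (P : ℕ → Prop) : IsBoundedUnder (· ≥ ·) atTop (freq P) :=
  isBoundedUnder_of ⟨0, freq_nonneg P⟩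

lemma freq_add_freq_not (P : ℕ → Prop) {m : ℕ} (hm : 0 < m) :
    freq P m + freq (fun k => ¬ P k) m = 1 - 1 / m := by
  have h := Finset.card_filter_add_card_filter_not (s := Finset.Ioo 0 m) P
  have h' : (((Finset.Ioo 0 m).filter P).card : ℝ) +
      ((Finset.Ioo 0 m).filter fun k => ¬ P k).card + 1 = m := by
    have : (Finset.Ioo 0 m).card = m - 1 := by simp
    norm_cast
    omega
  have hm' : (m : ℝ) ≠ 0 := by positivity
  unfold freq
  field_simp
  rw [eq_sub_iff_add_eq]
  convert h'

lemma freq_le_of_forall_not {P : ℕ → Prop} {m : ℕ} {ε : ℝ} (hε : 0 < ε)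
    (h : ∀ k : ℕ, ε * m ≤ k → k < m → ¬ P k) : freq P m ≤ ε := by
  unfold freq
  rcases Nat.eq_zero_or_pos m with rfl | hm
  · simpa using hε.le
  rw [div_le_iff₀ (by positivity)]
  have hsub : (Finset.Ioo 0 m).filter P ⊆ Finset.Ioo 0 ⌈ε * m⌉₊ := by
    intro k hk
    simp only [Finset.mem_filter, Finset.mem_Ioo] at hk ⊢
    refine ⟨hk.1.1, Nat.lt_ceil.2 ?_⟩
    by_contra! hle
    exact h k hle hk.1.2 hk.2
  have hc : 0 < ⌈ε * m⌉₊ := Nat.ceil_pos.2 (by positivity)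
  have h1 := Finset.card_le_card hsub
  simp only [Nat.card_Ioo] at h1
  have h2 : ((Finset.Ioo 0 m).filter P).card < ⌈ε * m⌉₊ := by omega
  exact (Nat.lt_ceil.1 h2).le

lemma limsup_freq_eq_one {P : ℕ → Prop}
    (h : ∀ ε : ℝ, 0 < ε → ∃ᶠ m : ℕ in atTop, ∀ k : ℕ, ε * m ≤ k → k < m → P k) :
    limsup (freq P) atTop = 1 := by
  refine le_antisymm (limsup_le_of_le (isBoundedUnder_ge_freq P).isCoboundedUnder_le
    (Eventually.of_forall (freq_le_one P))) (le_of_forall_pos_le_add fun ε hε => ?_)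
  rw [← sub_le_iff_le_add]
  refine le_limsup_of_frequently_le ?_ (isBoundedUnder_le_freq P)
  have hev : ∀ᶠ m : ℕ in atTop, 0 < m ∧ 1 / (m : ℝ) < ε / 2 :=
    (eventually_gt_atTop 0).and
      (tendsto_one_div_atTop_nhds_zero_nat.eventually_lt_const (half_pos hε))
  refine ((h (ε / 2) (half_pos hε)).and_eventually hev).mono fun m ⟨hm, hm0, hm1⟩ => ?_
  have h1 : freq (fun k => ¬ P k) m ≤ ε / 2 :=
    freq_le_of_forall_not (half_pos hε) fun k hk hk' => not_not.2 (hm k hk hk')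
  linarith [freq_add_freq_not P hm0]

lemma liminf_freq_eq_zero {P : ℕ → Prop}
    (h : ∀ ε : ℝ, 0 < ε → ∃ᶠ m : ℕ in atTop, ∀ k : ℕ, ε * m ≤ k → k < m → ¬ P k) :
    liminf (freq P) atTop = 0 := by
  refine le_antisymm (le_of_forall_pos_le_add fun ε hε => ?_)
    (le_liminf_of_le (isBoundedUnder_le_freq P).isCoboundedUnder_ge
      (Eventually.of_forall (freq_nonneg P)))
  rw [zero_add]
  exact liminf_le_of_frequently_le ((h ε hε).mono fun m hm => freq_le_of_forall_not hε hm)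
    (isBoundedUnder_ge_freq P)

lemma tendsto_freq_one {P : ℕ → Prop} (h : ∀ᶠ k in atTop, P k) :
    Tendsto (freq P) atTop (𝓝 1) := by
  obtain ⟨K, hK⟩ := eventually_atTop.1 h
  refine tendsto_order.2 ⟨fun a ha => ?_, fun a ha =>
    Eventually.of_forall fun m => (freq_le_one P m).trans_lt ha⟩
  have hε : 0 < (1 - a) / 2 := by linarith
  have hK' : Tendsto (fun m : ℕ => (1 - a) / 2 * (m : ℝ)) atTop atTop :=
    tendsto_natCast_atTop_atTop.const_mul_atTop hε
  filter_upwards [hK'.eventually_ge_atTop (K : ℝ), eventually_gt_atTop 0,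
    tendsto_one_div_atTop_nhds_zero_nat.eventually_lt_const hε] with m hm hm0 hm1
  have h1 : freq (fun k => ¬ P k) m ≤ (1 - a) / 2 :=
    freq_le_of_forall_not hε fun k hk _ => not_not.2 (hK k (by exact_mod_cast hm.trans hk))
  linarith [freq_add_freq_not P hm0]

lemma limsup_freq_lt_one {P : ℕ → Prop} (h : ∀ᶠ k in atTop, ¬ (P k ∧ P (2 * k))) :
    limsup (freq P) atTop < 1 := by
  obtain ⟨K, hK⟩ := eventually_atTop.1 h
  refine lt_of_le_of_lt (b := (7 / 8 : ℝ)) (limsup_le_of_le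
    (isBoundedUnder_ge_freq P).isCoboundedUnder_le ?_) (by norm_num)
  filter_upwards [eventually_ge_atTop (4 * K + 8)] with m hm
  set A := (Finset.Ioo 0 m).filter P with hA
  set B := (Finset.Ico (K + 1) (m / 2)).filter P with hB
  have hAB : A ⊆ B ∪ (Finset.Icc 1 K ∪ Finset.Ico (m / 2) m) := by
    intro k hk
    simp only [hA, hB, Finset.mem_filter, Finset.mem_Ioo, Finset.mem_union, Finset.mem_Ico,
      Finset.mem_Icc] at hk ⊢
    by_cases h1 : k ≤ K
    · right; left; omega
    · by_cases h2 : k < m / 2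
      · left; exact ⟨by omega, hk.2⟩
      · right; right; omega
  have hdisj : Disjoint A (B.image (2 * ·)) := by
    rw [Finset.disjoint_left]
    intro k hk hk'
    obtain ⟨j, hj, rfl⟩ := Finset.mem_image.1 hk'
    simp only [hA, hB, Finset.mem_filter, Finset.mem_Ioo, Finset.mem_Ico] at hk hj
    exact hK j (by omega) ⟨hj.2, hk.2⟩
  have hsub : A ∪ B.image (2 * ·) ⊆ Finset.Ioo 0 m := by
    refine Finset.union_subset (Finset.filter_subset _ _) fun k hk => ?_
    obtain ⟨j, hj, rfl⟩ := Finset.mem_image.1 hk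
    simp only [hB, Finset.mem_filter, Finset.mem_Ico] at hj
    simp only [Finset.mem_Ioo]
    omega
  have h1 := Finset.card_le_card hsub
  rw [Finset.card_union_of_disjoint hdisj,
    Finset.card_image_of_injective _ (mul_right_injective₀ two_ne_zero)] at h1
  have h2 := (Finset.card_le_card hAB).trans (Finset.card_union_le _ _)
  have h3 := Finset.card_union_le (Finset.Icc 1 K) (Finset.Ico (m / 2) m)
  simp only [Nat.card_Ioo, Nat.card_Icc, Nat.card_Ico] at h1 h2 h3
  have h4 : 8 * A.card ≤ 7 * m := by omega
  have h5 : (8 : ℝ) * A.card ≤ 7 * m := by exact_mod_cast h4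
  unfold freq
  rw [div_le_iff₀ (by norm_cast; omega)]
  linarith

lemma not_distScrambled2_of_tendsto_dist {X : Type*} [MetricSpace X] {f : X → X} {x y : X} {L : ℝ}
    (h : Tendsto (fun k => dist (f^[k] x) (f^[k] y)) atTop (𝓝 L)) : ¬ DistScrambled2 f x y := by
  rintro ⟨-, hup, δ, hδ, hlt⟩
  rcases (ge_of_tendsto' h fun _ => dist_nonneg).eq_or_lt with rfl | hL
  · have h1 := tendsto_freq_one (h.eventually_lt_const hδ)
    rw [lowerDF_eq_liminf_freq, upperDF_eq_limsup_freq, h1.liminf_eq, h1.limsup_eq] at hlt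
    exact lt_irrefl _ hlt
  · have h1 := hup (L / 2) (half_pos hL)
    rw [upperDF_eq_limsup_freq] at h1
    refine (limsup_freq_lt_one ?_).ne h1
    filter_upwards [h.eventually_const_lt (half_lt_self hL)] with k hk hk'
    exact hk.not_gt hk'.1

lemma DistScrambled2.symm {X : Type*} [MetricSpace X] {f : X → X} {x y : X}
    (h : DistScrambled2 f x y) : DistScrambled2 f y x := by
  simpa only [DistScrambled2, lowerDF, upperDF, dist_comm, ne_comm] using h

lemma DistScrambled1.distScrambled2 {X : Type*} [MetricSpace X] {f : X → X} {x y : X}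
    (h : DistScrambled1 f x y) : DistScrambled2 f x y := by
  obtain ⟨hne, hup, δ, hδ, -, hlow⟩ := h
  exact ⟨hne, hup, δ, hδ, by rw [hlow, hup δ hδ]; exact zero_lt_one⟩

/-- The angle at time `t ≥ 1` of the spiral with parameter `z`. -/
noncomputable def angle (z t : ℝ) : ℝ := Real.log t + z * Real.log (1 + Real.log t)

lemma log_one_add_log_sub_nonneg {s t : ℝ} (hs : 1 ≤ s) (hst : s ≤ t) :
    0 ≤ Real.log (1 + Real.log t) - Real.log (1 + Real.log s) := by
  have h1 := Real.log_nonneg hs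
  have h2 := Real.log_le_log (by linarith) hst
  exact sub_nonneg.2 (Real.log_le_log (by linarith) (by linarith))

lemma log_one_add_log_sub_le {s t : ℝ} (hs : 1 ≤ s) (hst : s ≤ t) :
    Real.log (1 + Real.log t) - Real.log (1 + Real.log s) ≤
      (Real.log t - Real.log s) / (1 + Real.log s) := by
  have h1 := Real.log_nonneg hs
  have h2 := Real.log_le_log (by linarith) hst
  rw [← Real.log_div (by linarith) (by linarith)]
  refine (Real.log_le_sub_one_of_pos (by apply div_pos <;> linarith)).trans (le_of_eq ?_)
  have : 1 + Real.log s ≠ 0 := by linarith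
  field_simp
  ring

lemma angle_sub_nonneg {z s t : ℝ} (hz : 0 ≤ z) (hs : 1 ≤ s) (hst : s ≤ t) :
    0 ≤ angle z t - angle z s := by
  have h2 := Real.log_le_log (by linarith) hst
  have h3 := mul_nonneg hz (log_one_add_log_sub_nonneg hs hst)
  unfold angle
  linarith

lemma angle_sub_le {z s t : ℝ} (hz : z ≤ 1) (hs : 1 ≤ s) (hst : s ≤ t) :
    angle z t - angle z s ≤ 2 * (Real.log t - Real.log s) := by
  have h1 := Real.log_nonneg hs
  have h2 := Real.log_le_log (by linarith) hst
  have h3 : (Real.log t - Real.log s) / (1 + Real.log s) ≤ Real.log t - Real.log s :=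
    div_le_self (by linarith) (by linarith)
  have h4 := log_one_add_log_sub_le hs hst
  have h5 := mul_le_mul_of_nonneg_right hz (log_one_add_log_sub_nonneg hs hst)
  unfold angle
  linarith

lemma tendsto_angle_add_natCast_sub {z x : ℝ} (hz : z ∈ Set.Icc (0 : ℝ) 1) (hx : 0 ≤ x) :
    Tendsto (fun k : ℕ => angle z (x + k) - angle z k) atTop (𝓝 0) := by
  have h := ((Real.tendsto_log_comp_add_sub_log x).comp tendsto_natCast_atTop_atTop).const_mul 2
  rw [mul_zero] at h
  refine tendsto_of_tendsto_of_tendsto_of_le_of_le' tendsto_const_nhds h ?_ ?_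
  · filter_upwards [eventually_ge_atTop 1] with k hk
    exact angle_sub_nonneg hz.1 (by exact_mod_cast hk) (by linarith)
  · filter_upwards [eventually_ge_atTop 1] with k hk
    have := angle_sub_le hz.2 (s := k) (t := x + k) (by exact_mod_cast hk) (by linarith)
    simpa [add_comm x] using this

lemma tendsto_angle_two_mul_sub (z : ℝ) :
    Tendsto (fun k : ℕ => angle z (2 * k) - angle z k) atTop (𝓝 (Real.log 2)) := by
  have hlog : Tendsto (fun k : ℕ => 1 + Real.log k) atTop atTop :=
    tendsto_atTop_add_const_left _ _ (Real.tendsto_log_atTop.comp tendsto_natCast_atTop_atTop)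
  have hE : Tendsto (fun k : ℕ => Real.log (1 + Real.log (2 * k)) - Real.log (1 + Real.log k))
      atTop (𝓝 0) := by
    refine tendsto_of_tendsto_of_tendsto_of_le_of_le' tendsto_const_nhds
      (hlog.const_div_atTop (Real.log 2)) ?_ ?_
    · filter_upwards [eventually_ge_atTop 1] with k hk
      have hk' : (1 : ℝ) ≤ k := by exact_mod_cast hk
      exact log_one_add_log_sub_nonneg hk' (by linarith)
    · filter_upwards [eventually_ge_atTop 1] with k hk
      have hk' : (1 : ℝ) ≤ k := by exact_mod_cast hk
      have := log_one_add_log_sub_le hk' (t := 2 * k) (by linarith)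
      rwa [Real.log_mul two_ne_zero (by linarith), add_sub_cancel_right,
        ← Real.log_mul two_ne_zero (by linarith)] at this
  have h := (hE.const_mul z).const_add (Real.log 2)
  rw [mul_zero, add_zero] at h
  refine h.congr' ?_
  filter_upwards [eventually_ge_atTop 1] with k hk
  have hk' : (k : ℝ) ≠ 0 := by positivity
  unfold angle
  rw [Real.log_mul two_ne_zero hk']
  ring

lemma Circle.dist_eq_dist_div_one (a b : Circle) : dist a b = dist (a / b) 1 := by
  change dist (a : ℂ) (b : ℂ) = dist ((a / b : Circle) : ℂ) ((1 : Circle) : ℂ)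
  rw [dist_eq_norm, dist_eq_norm, Circle.coe_div, Circle.coe_one, div_sub_one b.coe_ne_zero,
    norm_div, b.norm_coe, div_one]

lemma Circle.dist_mul_exp_mul_exp (a b : Circle) (s t : ℝ) :
    dist (a * Circle.exp s) (b * Circle.exp t) = dist (a / b * Circle.exp (s - t)) 1 := by
  rw [Circle.dist_eq_dist_div_one, Circle.exp_sub, mul_div_mul_comm]

/-- Along suitable arbitrarily long time windows, the slow rotation by `w * log (1 + log t)` is
close to a given point of the circle, except for a small initial part of the window. -/
lemma frequently_dist_exp_lt {w : ℝ} (hw : w ≠ 0) (q : Circle) {δ ε : ℝ} (hδ : 0 < δ)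
    (hε : 0 < ε) : ∃ᶠ m : ℕ in atTop, ∀ k : ℕ, ε * m ≤ k → k < m →
      dist (Circle.exp (w * Real.log (1 + Real.log (1 + k)))) q < δ := by
  obtain ⟨θ, hθ⟩ := Circle.exp_surjective q
  obtain ⟨η, hη, hη1⟩ : ∃ η > 0, ∀ s, |s| < η → dist (Circle.exp s) 1 < δ := by
    obtain ⟨η, hη, h⟩ := Metric.continuous_iff.1 Circle.exp.continuous 0 δ hδ
    exact ⟨η, hη, fun s hs => by simpa using h s (by simpa using hs)⟩
  have hw' : 0 < |w| := abs_pos.2 hw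
  obtain ⟨τ, hτ, hτq⟩ : ∃ τ : ℕ → ℝ, Tendsto τ atTop atTop ∧ ∀ j, Circle.exp (w * τ j) = q := by
    obtain ⟨n, hn⟩ : ∃ n : ℤ, w = n * |w| := by
      rcases abs_choice w with h | h
      · exact ⟨1, by simp [h]⟩
      · exact ⟨-1, by simp [h]⟩
    refine ⟨fun j => θ / w + j * (2 * Real.pi / |w|), tendsto_atTop_add_const_left _ _
      (tendsto_natCast_atTop_atTop.atTop_mul_const (by positivity)), fun j => ?_⟩
    have : w * (θ / w + j * (2 * Real.pi / |w|)) = θ + ((j * n : ℤ) : ℝ) * (2 * Real.pi) := by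
      have h1 : w * (2 * Real.pi / |w|) = n * (2 * Real.pi) := by
        rw [mul_div_left_comm]
        nth_rewrite 1 [hn]
        field_simp
      push_cast
      rw [mul_add, mul_div_cancel₀ _ hw, mul_left_comm, h1]
      ring
    rw [this, Circle.exp_add, Circle.exp_int_mul_two_pi, mul_one, hθ]
  set η' := η / (2 * |w|) with hη'
  have hη'0 : 0 < η' := by positivity
  have hexp := Real.tendsto_exp_atTop.comp hτ
  have hx : Tendsto (fun j => Real.exp (Real.exp (τ j) - 1)) atTop atTop :=
    Real.tendsto_exp_atTop.comp (tendsto_atTop_add_const_right _ _ hexp)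
  refine (tendsto_nat_floor_atTop.comp hx).frequently (Eventually.frequently ?_)
  have hgap : Tendsto (fun j => Real.exp (τ j) * (1 - Real.exp (-η'))) atTop atTop :=
    hexp.atTop_mul_const (sub_pos.2 (Real.exp_lt_one_iff.2 (neg_lt_zero.2 hη'0)))
  filter_upwards [hx.eventually_ge_atTop 1, hgap.eventually_ge_atTop (-Real.log (ε / 2))]
    with j hj1 hj2 k hk hkm
  simp only [Function.comp_apply] at hk hkm
  set x := Real.exp (Real.exp (τ j) - 1) with hxdef
  have hlogx : Real.log x = Real.exp (τ j) - 1 := Real.log_exp _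
  have hx1 : (⌊x⌋₊ : ℝ) ≤ x := Nat.floor_le (by linarith)
  have hx2 : x < ⌊x⌋₊ + 1 := Nat.lt_floor_add_one x
  have hx3 : (1 : ℝ) ≤ ⌊x⌋₊ := by exact_mod_cast Nat.one_le_floor_iff _ |>.2 hj1
  have hk1 : (k : ℝ) + 1 ≤ ⌊x⌋₊ := by exact_mod_cast hkm
  have hk0 : (0 : ℝ) ≤ k := k.cast_nonneg
  have hupper : Real.log (1 + k) ≤ Real.exp (τ j) - 1 :=
    hlogx ▸ Real.log_le_log (by linarith) (by linarith)
  have hlower : Real.log (ε / 2) + (Real.exp (τ j) - 1) ≤ Real.log (1 + k) := by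
    rw [← hlogx, ← Real.log_mul (by positivity) (by positivity)]
    exact Real.log_le_log (by positivity) (by nlinarith)
  have hpos := Real.log_nonneg (x := 1 + (k : ℝ)) (by linarith)
  have hL1 : Real.log (1 + Real.log (1 + k)) ≤ τ j :=
    (Real.log_le_iff_le_exp (by linarith)).2 (by linarith)
  have hL2 : τ j - η' ≤ Real.log (1 + Real.log (1 + k)) := by
    rw [Real.le_log_iff_exp_le (by linarith), sub_eq_add_neg, Real.exp_add]
    linarith
  rw [← hτq j, Circle.dist_eq_dist_div_one, ← Circle.exp_sub]
  refine hη1 _ ?_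
  rw [← mul_sub, abs_mul]
  have habs : |Real.log (1 + Real.log (1 + k)) - τ j| ≤ η' := abs_le.2 ⟨by linarith, by linarith⟩
  calc |w| * |Real.log (1 + Real.log (1 + k)) - τ j| ≤ |w| * η' := by gcongr
    _ = η / 2 := by rw [hη']; field_simp
    _ < η := half_lt_self hη

/-- The phase space: a height in `[0, 1]`, a point of the circle, and a parameter in `[0, 1]`. -/
abbrev SpiralSpace : Type := Set.Icc (0 : ℝ) 1 × Circle × Set.Icc (0 : ℝ) 1

/-- The height map `h ↦ h / (1 + h)`, that is, `1 / t ↦ 1 / (t + 1)`. -/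
noncomputable def heightMap (h : Set.Icc (0 : ℝ) 1) : Set.Icc (0 : ℝ) 1 :=
  ⟨h / (1 + h), div_nonneg h.2.1 (by linarith [h.2.1]),
    div_le_one_of_le₀ (by linarith) (by linarith [h.2.1])⟩

/-- The spiral map: the height decreases to `0`, the parameter is preserved, and the point of the
circle rotates at the decreasing speed prescribed by `angle`. -/
noncomputable def spiralMap (p : SpiralSpace) : SpiralSpace :=
  (heightMap p.1, p.2.1 * Circle.exp (angle p.2.2 (heightMap p.1 : ℝ)⁻¹ - angle p.2.2 (p.1 : ℝ)⁻¹),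
    p.2.2)

@[simp] lemma angle_zero (z : ℝ) : angle z 0 = 0 := by simp [angle]

lemma inv_heightMap {h : Set.Icc (0 : ℝ) 1} (hh : (h : ℝ) ≠ 0) :
    (heightMap h : ℝ)⁻¹ = (h : ℝ)⁻¹ + 1 := by
  simp only [heightMap]
  field_simp

lemma heightMap_eq_zero {h : Set.Icc (0 : ℝ) 1} (hh : (h : ℝ) = 0) : (heightMap h : ℝ) = 0 := by
  simp [heightMap, hh]

lemma spiralMap_of_eq_zero {p : SpiralSpace} (hp : (p.1 : ℝ) = 0) : spiralMap p = p := by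
  have h : heightMap p.1 = p.1 := Subtype.ext (by rw [heightMap_eq_zero hp, hp])
  simp [spiralMap, h]

lemma continuous_heightMap : Continuous heightMap := by
  unfold heightMap
  refine Continuous.subtype_mk (Continuous.div (by fun_prop) (by fun_prop) fun h => ?_) _
  linarith [h.2.1]

lemma abs_angle_heightMap_sub_le (h z : Set.Icc (0 : ℝ) 1) :
    |angle z (heightMap h : ℝ)⁻¹ - angle z (h : ℝ)⁻¹| ≤ 2 * h := by
  rcases eq_or_ne (h : ℝ) 0 with hh | hh
  · simp [heightMap_eq_zero hh, hh]
  have hpos : (0 : ℝ) < h := lt_of_le_of_ne h.2.1 hh.symm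
  have hinv : 1 ≤ (h : ℝ)⁻¹ := (one_le_inv₀ hpos).2 h.2.2
  rw [inv_heightMap hh, abs_of_nonneg (angle_sub_nonneg z.2.1 hinv (by linarith))]
  refine (angle_sub_le z.2.2 hinv (by linarith)).trans ?_
  rw [← Real.log_div (by positivity) (by positivity)]
  have h1 : ((h : ℝ)⁻¹ + 1) / (h : ℝ)⁻¹ = 1 + h := by field_simp
  rw [h1]
  linarith [Real.log_le_sub_one_of_pos (x := 1 + (h : ℝ)) (by linarith)]

lemma continuousAt_angle_inv {p : Set.Icc (0 : ℝ) 1 × Set.Icc (0 : ℝ) 1} (hp : (p.1 : ℝ) ≠ 0) :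
    ContinuousAt (fun p : Set.Icc (0 : ℝ) 1 × Set.Icc (0 : ℝ) 1 => angle p.2 (p.1 : ℝ)⁻¹) p := by
  have hpos : (0 : ℝ) < p.1 := lt_of_le_of_ne p.1.2.1 hp.symm
  have hlog := Real.log_nonneg ((one_le_inv₀ hpos).2 p.1.2.2)
  have h1 : ContinuousAt (fun p : Set.Icc (0 : ℝ) 1 × Set.Icc (0 : ℝ) 1 =>
      Real.log (p.1 : ℝ)⁻¹) p :=
    (ContinuousAt.inv₀ (f := fun p : Set.Icc (0 : ℝ) 1 × Set.Icc (0 : ℝ) 1 => (p.1 : ℝ))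
      (by fun_prop) hp).log (inv_ne_zero hp)
  exact h1.add (ContinuousAt.mul (by fun_prop) ((continuousAt_const.add h1).log
    (by simp only [Pi.add_apply]; linarith)))

lemma continuous_angle_heightMap_sub :
    Continuous fun p : Set.Icc (0 : ℝ) 1 × Set.Icc (0 : ℝ) 1 =>
      angle p.2 (heightMap p.1 : ℝ)⁻¹ - angle p.2 (p.1 : ℝ)⁻¹ := by
  refine continuous_iff_continuousAt.2 fun p => ?_
  rcases eq_or_ne (p.1 : ℝ) 0 with hp | hp
  · have h0 : Tendsto (fun p : Set.Icc (0 : ℝ) 1 × Set.Icc (0 : ℝ) 1 => 2 * (p.1 : ℝ))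
        (𝓝 p) (𝓝 0) := by
      have : Continuous fun p : Set.Icc (0 : ℝ) 1 × Set.Icc (0 : ℝ) 1 => 2 * (p.1 : ℝ) := by
        fun_prop
      simpa [hp] using this.tendsto p
    have := squeeze_zero_norm (f := fun p : Set.Icc (0 : ℝ) 1 × Set.Icc (0 : ℝ) 1 =>
      angle p.2 (heightMap p.1 : ℝ)⁻¹ - angle p.2 (p.1 : ℝ)⁻¹)
      (fun p => abs_angle_heightMap_sub_le p.1 p.2) h0
    simpa [ContinuousAt, hp, heightMap_eq_zero hp] using this
  · refine ContinuousAt.sub ?_ (continuousAt_angle_inv hp)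
    have hne : (heightMap p.1 : ℝ) ≠ 0 := by
      intro h
      have := inv_heightMap hp
      rw [h, inv_zero] at this
      linarith [inv_nonneg.2 p.1.2.1]
    exact ContinuousAt.comp (f := fun p : Set.Icc (0 : ℝ) 1 × Set.Icc (0 : ℝ) 1 =>
      (heightMap p.1, p.2)) (continuousAt_angle_inv (p := (heightMap p.1, p.2)) hne)
      ((continuous_heightMap.comp continuous_fst).prodMk continuous_snd).continuousAt

lemma continuous_spiralMap : Continuous spiralMap := by
  unfold spiralMap
  refine (continuous_heightMap.comp continuous_fst).prodMk (Continuous.prodMk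
    ((by fun_prop : Continuous fun p : SpiralSpace => p.2.1).mul ?_) (by fun_prop))
  exact Circle.exp.continuous.comp (continuous_angle_heightMap_sub.comp
    (by fun_prop : Continuous fun p : SpiralSpace => (p.1, p.2.2)))

lemma inv_iterate_spiralMap_height {p : SpiralSpace} (hp : (p.1 : ℝ) ≠ 0) (k : ℕ) :
    (((spiralMap^[k] p).1 : ℝ))⁻¹ = (p.1 : ℝ)⁻¹ + k := by
  induction k with
  | zero => simp
  | succ k ih =>
    rw [Function.iterate_succ_apply']
    have hne : ((spiralMap^[k] p).1 : ℝ) ≠ 0 := by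
      have : 0 < (p.1 : ℝ)⁻¹ := inv_pos.2 (lt_of_le_of_ne p.1.2.1 hp.symm)
      intro h
      rw [h, inv_zero] at ih
      linarith [k.cast_nonneg (α := ℝ)]
    change ((heightMap (spiralMap^[k] p).1 : Set.Icc (0 : ℝ) 1) : ℝ)⁻¹ = _
    rw [inv_heightMap hne, ih]
    push_cast
    ring

@[simp] lemma iterate_spiralMap_param (p : SpiralSpace) (k : ℕ) :
    (spiralMap^[k] p).2.2 = p.2.2 := by
  induction k with
  | zero => rfl
  | succ k ih => rw [Function.iterate_succ_apply', ← ih]; rfl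

lemma iterate_spiralMap_circle {p : SpiralSpace} (hp : (p.1 : ℝ) ≠ 0) (k : ℕ) :
    (spiralMap^[k] p).2.1 =
      p.2.1 * Circle.exp (angle p.2.2 ((p.1 : ℝ)⁻¹ + k) - angle p.2.2 (p.1 : ℝ)⁻¹) := by
  rw [← inv_iterate_spiralMap_height hp]
  induction k with
  | zero => simp
  | succ k ih =>
    rw [Function.iterate_succ_apply']
    change (spiralMap^[k] p).2.1 * Circle.exp (angle (spiralMap^[k] p).2.2
      (heightMap (spiralMap^[k] p).1 : ℝ)⁻¹ - angle (spiralMap^[k] p).2.2 _) = _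
    rw [ih, iterate_spiralMap_param, mul_assoc, ← Circle.exp_add, add_comm, sub_add_sub_cancel]
    rfl

lemma iterate_spiralMap_of_eq_zero {p : SpiralSpace} (hp : (p.1 : ℝ) = 0) (k : ℕ) :
    spiralMap^[k] p = p :=
  Function.iterate_fixed (spiralMap_of_eq_zero hp) k

lemma tendsto_iterate_spiralMap_height {p : SpiralSpace} (hp : (p.1 : ℝ) ≠ 0) :
    Tendsto (fun k => ((spiralMap^[k] p).1 : ℝ)) atTop (𝓝 0) := by
  have h : Tendsto (fun k : ℕ => ((p.1 : ℝ)⁻¹ + k)⁻¹) atTop (𝓝 0) :=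
    (tendsto_atTop_add_const_left _ _ tendsto_natCast_atTop_atTop).inv_tendsto_atTop
  refine h.congr fun k => ?_
  rw [← inv_iterate_spiralMap_height hp, inv_inv]

/-- Two points above height `0` with the same parameter have orbits whose distance converges. -/
lemma exists_tendsto_dist_iterate {p q : SpiralSpace} (hp : (p.1 : ℝ) ≠ 0) (hq : (q.1 : ℝ) ≠ 0)
    (hpq : p.2.2 = q.2.2) :
    ∃ L, Tendsto (fun k => dist (spiralMap^[k] p) (spiralMap^[k] q)) atTop (𝓝 L) := by
  have hheight : Tendsto (fun k => dist (spiralMap^[k] p).1 (spiralMap^[k] q).1) atTop (𝓝 0) := by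
    have := (tendsto_iterate_spiralMap_height hp).dist (tendsto_iterate_spiralMap_height hq)
    rwa [dist_self] at this
  have hangle : Tendsto (fun k : ℕ =>
      (angle p.2.2 ((p.1 : ℝ)⁻¹ + k) - angle p.2.2 (p.1 : ℝ)⁻¹) -
        (angle p.2.2 ((q.1 : ℝ)⁻¹ + k) - angle p.2.2 (q.1 : ℝ)⁻¹)) atTop
      (𝓝 (0 - 0 - (angle p.2.2 (p.1 : ℝ)⁻¹ - angle p.2.2 (q.1 : ℝ)⁻¹))) := by
    refine (((tendsto_angle_add_natCast_sub p.2.2.2 (inv_nonneg.2 p.1.2.1)).sub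
      (tendsto_angle_add_natCast_sub p.2.2.2 (inv_nonneg.2 q.1.2.1))).sub_const _).congr
      fun k => ?_
    ring
  have hcircle : Tendsto (fun k => dist (spiralMap^[k] p).2.1 (spiralMap^[k] q).2.1) atTop _ :=
    ((((Circle.exp.continuous.tendsto _).comp hangle).const_mul (p.2.1 / q.2.1)).dist
      (tendsto_const_nhds (x := 1))).congr fun k => by
        rw [iterate_spiralMap_circle hp, iterate_spiralMap_circle hq, ← hpq,
          Circle.dist_mul_exp_mul_exp]
        rfl
  refine ⟨_, (hheight.max (hcircle.max (tendsto_const_nhds (x := 0)))).congr fun k => ?_⟩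
  simp [Prod.dist_eq, hpq]

/-- A point above height `0` is not scrambled of type 2 with a fixed point: its orbit keeps
winding around the circle. -/
lemma not_distScrambled2_of_eq_zero {p q : SpiralSpace} (hp : (p.1 : ℝ) ≠ 0) (hq : (q.1 : ℝ) = 0) :
    ¬ DistScrambled2 spiralMap p q := by
  rintro ⟨-, hup, -⟩
  set d := dist (Circle.exp (Real.log 2)) 1 with hd
  have hd0 : 0 < d := by
    refine dist_pos.2 fun h => ?_
    have h2 : Real.log 2 < Real.pi := by
      linarith [Real.log_two_lt_d9, Real.pi_gt_three]
    have h3 := Circle.arg_exp (by linarith [Real.log_pos one_lt_two, Real.pi_pos]) h2.le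
    rw [h] at h3
    simp only [Circle.coe_one, Complex.arg_one] at h3
    exact (Real.log_pos one_lt_two).ne h3
  have hcircle : Tendsto
      (fun k => dist (spiralMap^[2 * k] p).2.1 (spiralMap^[k] p).2.1) atTop (𝓝 d) := by
    have hx := tendsto_angle_add_natCast_sub p.2.2.2 (inv_nonneg.2 p.1.2.1)
    have h2 : Tendsto (fun k : ℕ => 2 * k) atTop atTop :=
      tendsto_id.const_mul_atTop' two_pos
    have hangle := (((hx.comp h2).sub hx).add (tendsto_angle_two_mul_sub p.2.2))
    rw [sub_zero, zero_add] at hangle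
    refine (((Circle.exp.continuous.tendsto _).comp hangle).dist
      (tendsto_const_nhds (x := 1))).congr fun k => ?_
    rw [iterate_spiralMap_circle hp, iterate_spiralMap_circle hp, Circle.dist_mul_exp_mul_exp,
      div_self', one_mul]
    simp only [Function.comp_apply, Nat.cast_mul, Nat.cast_ofNat]
    congr 2
    ring
  have h1 := hup (d / 4) (by linarith)
  rw [upperDF_eq_limsup_freq] at h1
  refine (limsup_freq_lt_one ?_).ne h1
  filter_upwards [hcircle.eventually_const_lt (half_lt_self hd0)] with k hk ⟨hk1, hk2⟩
  rw [iterate_spiralMap_of_eq_zero hq, Prod.dist_eq, Prod.dist_eq] at hk1 hk2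
  have h3 := (max_lt_iff.1 (max_lt_iff.1 hk1).2).1
  have h4 := (max_lt_iff.1 (max_lt_iff.1 hk2).2).1
  linarith [dist_triangle_right (spiralMap^[2 * k] p).2.1 (spiralMap^[k] p).2.1 q.2.1]

lemma not_distScrambled2_spiralMap (p q : SpiralSpace) : ¬ DistScrambled2 spiralMap p q := by
  by_cases hz : p.2.2 = q.2.2
  · rcases eq_or_ne (p.1 : ℝ) 0 with hp | hp <;> rcases eq_or_ne (q.1 : ℝ) 0 with hq | hq
    · refine not_distScrambled2_of_tendsto_dist (L := dist p q) ?_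
      simp [iterate_spiralMap_of_eq_zero hp, iterate_spiralMap_of_eq_zero hq]
    · exact fun h => not_distScrambled2_of_eq_zero hq hp h.symm
    · exact not_distScrambled2_of_eq_zero hp hq
    · obtain ⟨L, hL⟩ := exists_tendsto_dist_iterate hp hq hz
      exact not_distScrambled2_of_tendsto_dist hL
  · rintro ⟨-, hup, -⟩
    have h1 := hup _ (dist_pos.2 hz)
    rw [upperDF_eq_limsup_freq] at h1
    refine (limsup_freq_lt_one (Eventually.of_forall fun k hk => ?_)).ne h1
    have h2 := hk.1
    rw [Prod.dist_eq, Prod.dist_eq, iterate_spiralMap_param, iterate_spiralMap_param] at h2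
    exact lt_irrefl _ (max_lt_iff.1 (max_lt_iff.1 h2).2).2

/-- The point of height `1`, angle `0` and parameter `z`. -/
noncomputable def spiralStart (z : Set.Icc (0 : ℝ) 1) : SpiralSpace := (1, 1, z)

lemma inv_iterate_spiralStart_height (z : Set.Icc (0 : ℝ) 1) (k : ℕ) :
    (((spiralMap^[k] (spiralStart z)).1 : ℝ))⁻¹ = 1 + k := by
  rw [inv_iterate_spiralMap_height] <;> simp [spiralStart]

lemma dist_iterate_spiralStart_height (z w : Set.Icc (0 : ℝ) 1) (k : ℕ) :
    dist (spiralMap^[k] (spiralStart z)).1 (spiralMap^[k] (spiralStart w)).1 = 0 := by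
  rw [dist_eq_zero]
  apply Subtype.ext
  rw [← inv_inj, inv_iterate_spiralStart_height, inv_iterate_spiralStart_height]

lemma dist_iterate_spiralStart_circle (z w : Set.Icc (0 : ℝ) 1) (k : ℕ) :
    dist (spiralMap^[k] (spiralStart z)).2.1 (spiralMap^[k] (spiralStart w)).2.1 =
      dist (Circle.exp ((z - w : ℝ) * Real.log (1 + Real.log (1 + k)))) 1 := by
  rw [iterate_spiralMap_circle (by simp [spiralStart]),
    iterate_spiralMap_circle (by simp [spiralStart]), Circle.dist_mul_exp_mul_exp]
  simp only [spiralStart, div_self', one_mul]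
  congr 2
  simp [angle]
  ring

lemma frequently_dist_iterate_spiralStart_lt {z w : Set.Icc (0 : ℝ) 1} (hzw : z ≠ w) {δ ε : ℝ}
    (hδ : 0 < δ) (hε : 0 < ε) : ∃ᶠ m : ℕ in atTop, ∀ k : ℕ, ε * m ≤ k → k < m →
      dist (spiralMap^[k] (spiralStart z)).2.1 (spiralMap^[k] (spiralStart w)).2.1 < δ := by
  simp only [dist_iterate_spiralStart_circle]
  exact frequently_dist_exp_lt (sub_ne_zero.2 (Subtype.coe_ne_coe.2 hzw)) 1 hδ hε

lemma frequently_lt_dist_iterate_spiralStart {z w : Set.Icc (0 : ℝ) 1} (hzw : z ≠ w) {ε : ℝ}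
    (hε : 0 < ε) : ∃ᶠ m : ℕ in atTop, ∀ k : ℕ, ε * m ≤ k → k < m →
      3 / 2 < dist (spiralMap^[k] (spiralStart z)).2.1 (spiralMap^[k] (spiralStart w)).2.1 := by
  simp only [dist_iterate_spiralStart_circle]
  refine (frequently_dist_exp_lt (sub_ne_zero.2 (Subtype.coe_ne_coe.2 hzw)) (-1)
    (δ := 1 / 2) (by norm_num) hε).mono fun m hm k hk hkm => ?_
  have h1 := hm k hk hkm
  have h2 : dist (-1 : Circle) 1 = 2 := by
    change dist ((-1 : Circle) : ℂ) ((1 : Circle) : ℂ) = 2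
    rw [dist_eq_norm, Circle.coe_neg, Circle.coe_one]
    norm_num
  linarith [dist_triangle_left (-1 : Circle) 1
    (Circle.exp ((z - w : ℝ) * Real.log (1 + Real.log (1 + k))))]

lemma distScrambled3_spiralStart {z w : Set.Icc (0 : ℝ) 1} (hzw : z ≠ w) :
    DistScrambled3 spiralMap (spiralStart z) (spiralStart w) := by
  refine ⟨fun h => hzw (congrArg (·.2.2) h), 3 / 2, by norm_num, ?_⟩
  have hz : dist z w < 3 / 2 := by
    rw [Subtype.dist_eq, Real.dist_eq]
    exact (abs_sub_lt_iff.2 ⟨by linarith [z.2.2, w.2.1], by linarith [w.2.2, z.2.1]⟩)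
  have hiff : ∀ k, dist (spiralMap^[k] (spiralStart z)) (spiralMap^[k] (spiralStart w)) < 3 / 2 ↔
      dist (spiralMap^[k] (spiralStart z)).2.1 (spiralMap^[k] (spiralStart w)).2.1 < 3 / 2 := by
    intro k
    rw [Prod.dist_eq, Prod.dist_eq, dist_iterate_spiralStart_height, iterate_spiralMap_param,
      iterate_spiralMap_param, max_lt_iff, max_lt_iff]
    exact ⟨fun h => h.2.1, fun h => ⟨by norm_num, h, hz⟩⟩
  rw [lowerDF_eq_liminf_freq, upperDF_eq_limsup_freq]
  simp only [hiff]
  rw [liminf_freq_eq_zero, limsup_freq_eq_one]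
  · exact zero_lt_one
  · exact fun ε hε => frequently_dist_iterate_spiralStart_lt hzw (by norm_num) hε
  · exact fun ε hε => (frequently_lt_dist_iterate_spiralStart hzw hε).mono
      fun m hm k hk hkm => (hm k hk hkm).not_gt

/-- The map forgetting the parameter at height `0`. -/
def collapse (p : SpiralSpace) : ℝ × Circle × ℝ := (p.1, p.2.1, p.1 * p.2.2)

lemma continuous_collapse : Continuous collapse := by
  unfold collapse
  fun_prop

lemma collapse_spiralMap_eq {p q : SpiralSpace} (h : collapse p = collapse q) :
    collapse (spiralMap p) = collapse (spiralMap q) := by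
  have h1 : (p.1 : ℝ) = q.1 := congrArg (·.1) h
  have h2 : p.2.1 = q.2.1 := congrArg (·.2.1) h
  have h3 : (p.1 : ℝ) * p.2.2 = q.1 * q.2.2 := congrArg (·.2.2) h
  rcases eq_or_ne (p.1 : ℝ) 0 with hp | hp
  · rw [spiralMap_of_eq_zero hp, spiralMap_of_eq_zero (h1 ▸ hp), h]
  · rw [← h1] at h3
    have : p = q := Prod.ext (Subtype.ext h1)
      (Prod.ext h2 (Subtype.ext (mul_left_cancel₀ hp h3)))
    rw [this]

lemma exists_factor_of_surjective {X Y : Type*} [TopologicalSpace X] [CompactSpace X]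
    [TopologicalSpace Y] [T2Space Y] {F : X → X} {π : X → Y} (hF : Continuous F)
    (hπ : Continuous π) (hs : Function.Surjective π)
    (h : ∀ p q, π p = π q → π (F p) = π (F q)) :
    ∃ f : Y → Y, Continuous f ∧ π ∘ F = f ∘ π := by
  have hcomp : π ∘ F = (fun y => π (F (Function.surjInv hs y))) ∘ π :=
    funext fun p => h _ _ (Function.surjInv_eq hs (π p)).symm
  refine ⟨_, ?_, hcomp⟩
  rw [(Topology.IsQuotientMap.of_surjective_continuous hs hπ).continuous_iff, ← hcomp]
  exact hπ.comp hF

lemma distScrambled1_collapse_spiralStart {f : Set.range collapse → Set.range collapse}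
    (hf : Set.rangeFactorization collapse ∘ spiralMap = f ∘ Set.rangeFactorization collapse)
    {z w : Set.Icc (0 : ℝ) 1} (hzw : z ≠ w) :
    DistScrambled1 f (Set.rangeFactorization collapse (spiralStart z))
      (Set.rangeFactorization collapse (spiralStart w)) := by
  have hsemi : Function.Semiconj (Set.rangeFactorization collapse) spiralMap f := congrFun hf
  have : CompactSpace (Set.range collapse) :=
    isCompact_iff_compactSpace.1 (isCompact_range continuous_collapse)
  have hdist : ∀ k, dist (f^[k] (Set.rangeFactorization collapse (spiralStart z)))
      (f^[k] (Set.rangeFactorization collapse (spiralStart w))) =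
      max (dist (spiralMap^[k] (spiralStart z)).2.1 (spiralMap^[k] (spiralStart w)).2.1)
        ((1 + k : ℝ)⁻¹ * dist z w) := by
    intro k
    rw [← (hsemi.iterate_right k).eq, ← (hsemi.iterate_right k).eq, Subtype.dist_eq,
      Set.rangeFactorization_coe, Set.rangeFactorization_coe]
    have h1 : ∀ z, ((spiralMap^[k] (spiralStart z)).1 : ℝ) = (1 + k : ℝ)⁻¹ := fun z => by
      rw [← inv_iterate_spiralStart_height z, inv_inv]
    simp only [collapse, Prod.dist_eq, iterate_spiralMap_param, h1, dist_self]
    rw [max_eq_right (le_max_of_le_left dist_nonneg), Subtype.dist_eq, Real.dist_eq, Real.dist_eq,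
      ← mul_sub, abs_mul, abs_of_nonneg (by positivity : 0 ≤ (1 + k : ℝ)⁻¹)]
    rfl
  refine ⟨fun h => hzw ?_, fun δ hδ => ?_, 3 / 2, by norm_num, ?_, ?_⟩
  · have h1 : (1 : ℝ) * z = 1 * w := congrArg (fun y => y.1.2.2) h
    exact Subtype.ext (by simpa using h1)
  · rw [upperDF_eq_limsup_freq]
    refine limsup_freq_eq_one fun ε hε => ?_
    have hlim : Tendsto (fun m : ℕ => (1 + ε * m)⁻¹ * dist z w) atTop (𝓝 0) := by
      have := (tendsto_atTop_add_const_left atTop 1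
        (tendsto_natCast_atTop_atTop.const_mul_atTop hε)).inv_tendsto_atTop.mul_const (dist z w)
      rwa [zero_mul] at this
    refine ((frequently_dist_iterate_spiralStart_lt hzw hδ hε).and_eventually
      (hlim.eventually_lt_const hδ)).mono fun m ⟨hm, hm'⟩ k hk hkm => ?_
    rw [hdist]
    refine max_lt (hm k hk hkm) (lt_of_le_of_lt ?_ hm')
    gcongr
  · obtain ⟨m, hm, hm0⟩ := ((frequently_lt_dist_iterate_spiralStart hzw one_half_pos).and_eventually
      (eventually_gt_atTop 1)).exists
    have h1 := hm (m - 1) (by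
      rw [Nat.cast_sub hm0.le]
      have : (2 : ℝ) ≤ m := by exact_mod_cast hm0
      push_cast
      linarith) (by omega)
    refine h1.le.trans ((le_max_left _ _).trans ((hdist (m - 1)).symm.le.trans ?_))
    exact dist_le_diam_of_mem isCompact_univ.isBounded (Set.mem_univ _) (Set.mem_univ _)
  · rw [lowerDF_eq_liminf_freq]
    refine liminf_freq_eq_zero fun ε hε => (frequently_lt_dist_iterate_spiralStart hzw hε).mono
      fun m hm k hk hkm => ?_
    rw [hdist]
    exact fun h => (hm k hk hkm).not_gt (max_lt_iff.1 h).1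

lemma not_countable_range_of_injective {α : Type*} {g : Set.Icc (0 : ℝ) 1 → α}
    (hg : Function.Injective g) : ¬ (Set.range g).Countable := by
  intro h
  have h1 : (Set.univ : Set (Set.Icc (0 : ℝ) 1)).Countable := by
    refine Set.countable_of_injective_of_countable_image hg.injOn ?_
    rwa [Set.image_univ]
  have h2 : (Set.Icc (0 : ℝ) 1).Countable := Set.countable_coe_iff.1 (Set.countable_univ_iff.1 h1)
  exact Cardinal.Real.Icc_countable_iff.not.2 (by norm_num) h2

/-- There is a compact system `(X, F)` with an uncountable set `T` all of whose
distinct pairs are distributionally scrambled of type 3, yet no pair of distinct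
points of `X` is distributionally scrambled of type 2 (hence none of type 1);
moreover `(X, F)` admits a factor `(Y, f)` that is distributionally chaotic of
type 1. -/
theorem stmt2 :
    ∃ (X : Type) (_ : MetricSpace X) (_ : CompactSpace X) (F : X → X),
      Continuous F ∧
      (∃ T : Set X, ¬ T.Countable ∧
        ∀ u ∈ T, ∀ v ∈ T, u ≠ v → DistScrambled3 F u v) ∧
      (∀ u v : X, u ≠ v → ¬ DistScrambled2 F u v) ∧
      (∀ u v : X, u ≠ v → ¬ DistScrambled1 F u v) ∧
      (∃ (Y : Type) (_ : MetricSpace Y) (_ : CompactSpace Y)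
        (f : Y → Y) (π : X → Y),
        Continuous f ∧ Continuous π ∧ Function.Surjective π ∧
        π ∘ F = f ∘ π ∧
        ∃ S : Set Y, ¬ S.Countable ∧
          ∀ u ∈ S, ∀ v ∈ S, u ≠ v → DistScrambled1 f u v) := by
  have : CompactSpace (Set.range collapse) :=
    isCompact_iff_compactSpace.1 (isCompact_range continuous_collapse)
  have hcont : Continuous (Set.rangeFactorization collapse) :=
    continuous_collapse.subtype_mk _
  obtain ⟨f, hf, hcomp⟩ := exists_factor_of_surjective continuous_spiralMap hcont
    Set.rangeFactorization_surjective
    fun p q h => Subtype.ext (collapse_spiralMap_eq (congrArg Subtype.val h))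
  refine ⟨SpiralSpace, inferInstance, inferInstance, spiralMap, continuous_spiralMap,
    ⟨Set.range spiralStart, not_countable_range_of_injective fun z w h => congrArg (·.2.2) h, ?_⟩,
    fun u v _ => not_distScrambled2_spiralMap u v,
    fun u v _ h => not_distScrambled2_spiralMap u v h.distScrambled2,
    Set.range collapse, inferInstance, inferInstance, f, Set.rangeFactorization collapse, hf, hcont,
    Set.rangeFactorization_surjective, hcomp,
    Set.range fun z => Set.rangeFactorization collapse (spiralStart z),
    not_countable_range_of_injective fun z w h => ?_, ?_⟩
  · rintro _ ⟨z, rfl⟩ _ ⟨w, rfl⟩ h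
    exact distScrambled3_spiralStart fun hzw => h (congrArg spiralStart hzw)
  · by_contra hzw
    exact (distScrambled1_collapse_spiralStart hcomp hzw).1 h
  · rintro _ ⟨z, rfl⟩ _ ⟨w, rfl⟩ h
    exact distScrambled1_collapse_spiralStart hcomp fun hzw => h (by rw [hzw])
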